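/- For every integer j and natural number n, there exists a partition of n with BG-rank equal to j if and only if j + n is even and j(2j−1) ≤ n. -/

import Mathlib

/-- A partition, represented as a weakly decreasing list of positive integers. -/
def IsPartition (l : List ℕ) : Prop :=
  l.Pairwise (· ≥ ·) ∧ ∀ x ∈ l, 0 < x

/-- The BG-rank of a partition `λ₁ ≥ λ₂ ≥ …`:  `Σᵢ (−1)^(i+1) (λᵢ mod 2)`
(with 1-based indexing, i.e. the first part contributes with sign `+1`). -/
def bgRank (l : List ℕ) : ℤ :=
  ∑ i ∈ Finset.range l.length, (-1 : ℤ) ^ i * ((l.getD i 0 : ℤ) % 2)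

/-- `p n`, the number of partitions of `n`. -/
noncomputable def partitionCount (n : ℕ) : ℕ :=
  Nat.card {l : List ℕ // IsPartition l ∧ l.sum = n}

/-- `p_j(n)`, the number of partitions of `n` with BG-rank `j`. -/
noncomputable def pj (j : ℤ) (n : ℕ) : ℕ :=
  Nat.card {l : List ℕ // IsPartition l ∧ l.sum = n ∧ bgRank l = j}

/-- `pp n`, the number of ordered pairs of partitions of total size `n`. -/
noncomputable def pp (n : ℕ) : ℕ :=
  ∑ k ∈ Finset.range (n + 1), partitionCount k * partitionCount (n - k)


theorem bgRank_nil' : bgRank [] = 0 := by simp [bgRank]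

theorem bgRank_cons' (a : ℕ) (l : List ℕ) : bgRank (a :: l) = (a : ℤ) % 2 - bgRank l := by
  unfold bgRank
  rw [List.length_cons, Finset.sum_range_succ']
  simp only [List.getD_cons_succ, List.getD_cons_zero, pow_succ, pow_zero, one_mul]
  rw [add_comm, sub_eq_add_neg, ← Finset.sum_neg_distrib]
  congr 1
  apply Finset.sum_congr rfl
  intros
  ring

theorem bg_bound (l : List ℕ) : IsPartition l →
    Even (bgRank l + (l.sum : ℤ)) ∧ bgRank l * (2 * bgRank l - 1) ≤ (l.sum : ℤ) ∧
    ∀ m : ℕ, (∀ x ∈ l, x ≤ m) →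
      2 * bgRank l ≤ (m : ℤ) + (m : ℤ) % 2 ∧ -(2 * bgRank l) ≤ (m : ℤ) - (m : ℤ) % 2 := by
  induction l with
  | nil =>
    intro _
    simp only [bgRank_nil']
    refine ⟨by simp, by simp, fun m _ => ?_⟩
    omega
  | cons a t ih =>
    rintro ⟨h1, h2⟩
    rw [List.pairwise_cons] at h1
    obtain ⟨e, b, c⟩ := ih ⟨h1.2, fun x hx => h2 x (by simp [hx])⟩
    have c' := c a (fun x hx => h1.1 x hx)
    rw [bgRank_cons', List.sum_cons]
    generalize bgRank t = j at *
    generalize t.sum = S at *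
    push_cast
    refine ⟨?_, ?_, ?_⟩
    · rw [Int.even_iff] at *
      omega
    · rcases Int.emod_two_eq_zero_or_one (a : ℤ) with h | h <;> rw [h] at c' ⊢ <;> nlinarith
    · intro m hm
      have := hm a (by simp)
      omega

def stair : ℕ → List ℕ
  | 0 => []
  | s + 1 => (s + 1) :: stair s

theorem stair_le (s : ℕ) : ∀ x ∈ stair s, 0 < x ∧ x ≤ s := by
  induction s with
  | zero => simp [stair]
  | succ s ih =>
    intro x hx
    simp only [stair, List.mem_cons] at hx
    rcases hx with h | h
    · omega
    · have := ih x h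
      omega

theorem cons_stair (s a : ℕ) (h : s < a) (hs : IsPartition (stair s)) :
    IsPartition (a :: stair s) := by
  refine ⟨List.pairwise_cons.2 ⟨fun x hx => ?_, hs.1⟩, fun x hx => ?_⟩
  · have := stair_le s x hx
    show x ≤ a
    omega
  · rcases List.mem_cons.1 hx with h | h
    · omega
    · exact hs.2 x h

theorem stair_part (s : ℕ) : IsPartition (stair s) := by
  induction s with
  | zero => simp [stair, IsPartition]
  | succ s ih => exact cons_stair s (s + 1) (by omega) ih

theorem stair_even (k : ℕ) : (stair (2 * k)).sum = k * (2 * k + 1) ∧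
    bgRank (stair (2 * k)) = -(k : ℤ) := by
  induction k with
  | zero => simp [stair, bgRank_nil']
  | succ k ih =>
    rw [show 2 * (k + 1) = 2 * k + 1 + 1 by ring]
    simp only [stair, List.sum_cons, bgRank_cons', ih.1, ih.2]
    refine ⟨by ring, ?_⟩
    push_cast
    omega

theorem exists_partition_with_bgrank_iff (j : ℤ) (n : ℕ) :
    (∃ l : List ℕ, IsPartition l ∧ l.sum = n ∧ bgRank l = j) ↔
      Even (j + n) ∧ j * (2 * j - 1) ≤ (n : ℤ) := by
  constructor
  · rintro ⟨l, hl, rfl, rfl⟩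
    exact ⟨(bg_bound l hl).1, (bg_bound l hl).2.1⟩
  · rintro ⟨he, hle⟩
    have hr : ∃ r : ℕ, (n : ℤ) = j * (2 * j - 1) + 2 * r := by
      have h2 : Even ((n : ℤ) - j * (2 * j - 1)) := by
        have : (n : ℤ) - j * (2 * j - 1) = (j + n) - 2 * (j * j) := by ring
        rw [this]
        exact he.sub (even_two_mul _)
      obtain ⟨q, hq⟩ := h2
      exact ⟨q.toNat, by omega⟩
    obtain ⟨r, hr⟩ := hr
    rcases lt_trichotomy j 0 with hj | hj | hj
    · obtain ⟨k, rfl⟩ : ∃ k : ℕ, j = -((k : ℤ) + 1) := ⟨(-j - 1).toNat, by omega⟩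
      refine ⟨(2 * k + 2 + 2 * r) :: stair (2 * k + 1),
        cons_stair _ _ (by omega) (stair_part _), ?_, ?_⟩
      · simp only [stair, List.sum_cons, (stair_even k).1]
        zify
        rw [hr]
        ring
      · simp only [stair, bgRank_cons', (stair_even k).2]
        push_cast
        omega
    · subst hj
      rcases Nat.eq_zero_or_pos n with h | h
      · exact ⟨[], by simp [IsPartition], by simp [h], bgRank_nil'⟩
      · refine ⟨[n], by simp [IsPartition, h], by simp, ?_⟩
        rw [bgRank_cons', bgRank_nil']
        omega
    · obtain ⟨k, rfl⟩ : ∃ k : ℕ, j = (k : ℤ) + 1 := ⟨(j - 1).toNat, by omega⟩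
      refine ⟨(2 * k + 1 + 2 * r) :: stair (2 * k),
        cons_stair _ _ (by omega) (stair_part _), ?_, ?_⟩
      · simp only [List.sum_cons, (stair_even k).1]
        zify
        rw [hr]
        ring
      · simp only [bgRank_cons', (stair_even k).2]
        push_cast
        omega
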